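/- Let X be a real Banach space and J ⊆ X a proper M-ideal (an M-ideal that is not an M-summand) of infinite codimension (i.e. X/J is infinite dimensional). If x₀ ∈ S_X is a point of weak-to-norm continuity of B_X (the identity from (B_X, σ(X,X*)) to (B_X, norm) is continuous at x₀), then dist(x₀, J) = 1 and π(x₀) is a point of weak-to-norm continuity of B_{X/J}, where π : X → X/J is the quotient map; in particular, J contains no points of weak-to-norm continuity of B_X lying in S_X. -/

import Mathlib

/-!
STATEMENT 11: Let `J ⊆ X` be a proper M-ideal of infinite codimension (`X/J` infinite
dimensional). If `x₀ ∈ S_X` is a point of weak-to-norm continuity of `B_X`, then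
`dist(x₀, J) = 1` and `π(x₀)` is a point of weak-to-norm continuity of `B_{X/J}`;
in particular `J` contains no points of weak-to-norm continuity of `B_X` on `S_X`.
-/

noncomputable section

open NormedSpace

/-- The weak topology `σ(Z, Z*)` on a normed space `Z`. -/
def weakTop (Z : Type*) [SeminormedAddCommGroup Z] [NormedSpace ℝ Z] :
    TopologicalSpace Z :=
  ⨅ f : Z →L[ℝ] ℝ, TopologicalSpace.induced (fun z : Z => f z) inferInstance

/-- `z₀` is a point of weak-to-norm continuity of the unit ball `B_Z`: the identity
map from `(B_Z, σ(Z,Z*))` to `(B_Z, norm)` is continuous at `z₀`. -/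
def IsWeakNormPC (Z : Type*) [SeminormedAddCommGroup Z] [NormedSpace ℝ Z] (z₀ : Z) : Prop :=
  @ContinuousWithinAt Z Z (weakTop Z) inferInstance id {z : Z | ‖z‖ ≤ 1} z₀

/-- `J` is an M-ideal in `Z`: there is a bounded linear projection `P : Z* → Z*` with
kernel `J^⊥` such that `‖f‖ = ‖P f‖ + ‖f − P f‖` for all `f ∈ Z*`. -/
def IsMIdeal (Z : Type*) [SeminormedAddCommGroup Z] [NormedSpace ℝ Z]
    (J : Submodule ℝ Z) : Prop :=
  ∃ P : (Z →L[ℝ] ℝ) →L[ℝ] (Z →L[ℝ] ℝ),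
    P.comp P = P ∧
    (∀ f : Z →L[ℝ] ℝ, P f = 0 ↔ ∀ z ∈ J, f z = 0) ∧
    ∀ f : Z →L[ℝ] ℝ, ‖f‖ = ‖P f‖ + ‖f - P f‖

/-- `J` is an M-summand in `Z`. -/
def IsMSummand (Z : Type*) [SeminormedAddCommGroup Z] [NormedSpace ℝ Z]
    (J : Submodule ℝ Z) : Prop :=
  ∃ Q : Z →L[ℝ] Z, Q.comp Q = Q ∧ Set.range Q = (J : Set Z) ∧
    ∀ z : Z, ‖z‖ = max ‖Q z‖ ‖z - Q z‖

theorem isWeakNormPC_iff {Z : Type*} [SeminormedAddCommGroup Z] [NormedSpace ℝ Z] {z₀ : Z} :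
    IsWeakNormPC Z z₀ ↔ ∀ ε > 0, ∃ F : Finset (Z →L[ℝ] ℝ), ∃ δ > 0, ∀ z : Z, ‖z‖ ≤ 1 →
      (∀ f ∈ F, |f z - f z₀| < δ) → ‖z - z₀‖ < ε := by
  have hnhds : @nhds Z (weakTop Z) z₀ =
      Filter.comap (fun (z : Z) (f : Z →L[ℝ] ℝ) => f z)
        (Filter.pi fun f : Z →L[ℝ] ℝ => nhds (f z₀)) := by
    rw [weakTop, nhds_iInf, Filter.pi, Filter.comap_iInf]
    simp only [nhds_induced, Filter.comap_comap]
    rfl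
  have hbasis := (Filter.hasBasis_pi fun f : Z →L[ℝ] ℝ =>
    Metric.nhds_basis_ball (x := f z₀)).comap (fun (z : Z) (f : Z →L[ℝ] ℝ) => f z)
  rw [← hnhds] at hbasis
  have hwithin := Filter.HasBasis.inf_principal hbasis {z : Z | ‖z‖ ≤ 1}
  unfold IsWeakNormPC ContinuousWithinAt nhdsWithin
  rw [hwithin.tendsto_iff Metric.nhds_basis_ball]
  refine forall₂_congr fun ε _ => ⟨?_, ?_⟩
  · rintro ⟨⟨F, r⟩, ⟨hF, hr⟩, h⟩
    obtain ⟨δ, hδ, hle⟩ : ∃ δ > 0, ∀ f ∈ hF.toFinset, δ ≤ r f := by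
      rcases hF.toFinset.eq_empty_or_nonempty with he | hne
      · exact ⟨1, one_pos, by simp [he]⟩
      · refine ⟨hF.toFinset.inf' hne r, ?_, fun f hf => Finset.inf'_le r hf⟩
        exact (Finset.lt_inf'_iff hne).2 fun f hf => hr f (hF.mem_toFinset.1 hf)
    refine ⟨hF.toFinset, δ, hδ, fun z hz hzF => ?_⟩
    have := h z ⟨fun f hf => ?_, hz⟩
    · simpa [dist_eq_norm] using this
    · have hf' := hF.mem_toFinset.2 hf
      exact Metric.mem_ball.2 ((hzF f hf').trans_le (hle f hf'))
  · rintro ⟨F, δ, hδ, h⟩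
    refine ⟨⟨F, fun _ => δ⟩, ⟨F.finite_toSet, fun _ _ => hδ⟩, ?_⟩
    rintro z ⟨hzF, hz⟩
    have := h z hz fun f hf => hzF f hf
    simpa [dist_eq_norm] using this

/-- Goldstine's theorem in finitary form. -/
theorem exists_norm_le_one_forall_abs_sub_lt {Z : Type*} [SeminormedAddCommGroup Z]
    [NormedSpace ℝ Z] (φ : (Z →L[ℝ] ℝ) →ₗ[ℝ] ℝ) (hφ : ∀ f, φ f ≤ ‖f‖)
    (F : Finset (Z →L[ℝ] ℝ)) {δ : ℝ} (hδ : 0 < δ) :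
    ∃ z : Z, ‖z‖ ≤ 1 ∧ ∀ f ∈ F, |f z - φ f| < δ := by
  classical
  let T : Z →ₗ[ℝ] (F → ℝ) := LinearMap.pi fun f => (f : Z →L[ℝ] ℝ).toLinearMap
  let p : F → ℝ := fun f => φ f
  by_cases hp : p ∈ closure (T '' Metric.closedBall 0 1)
  · obtain ⟨_, ⟨z, hz, rfl⟩, hpz⟩ := Metric.mem_closure_iff.1 hp δ hδ
    refine ⟨z, by simpa using hz, fun f hf => ?_⟩
    have := (dist_le_pi_dist p (T z) ⟨f, hf⟩).trans_lt hpz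
    rwa [dist_comm] at this
  · exfalso
    obtain ⟨g, u, hu, hgu⟩ := geometric_hahn_banach_closed_point
      ((convex_closedBall (0 : Z) 1).linear_image T).closure isClosed_closure hp
    have hg : ∀ v : F → ℝ, g v = ∑ i, v i * g (Pi.single i 1) := fun v => by
      conv_lhs => rw [← Finset.univ_sum_single v, map_sum]
      refine Finset.sum_congr rfl fun i _ => ?_
      rw [← smul_eq_mul, ← map_smul, ← Pi.single_smul', smul_eq_mul, mul_one]
    let h : Z →L[ℝ] ℝ := ∑ i : F, g (Pi.single i 1) • (i : Z →L[ℝ] ℝ)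
    have hhT : ∀ z, h z = g (T z) := fun z => by
      rw [hg]
      simp [h, T, mul_comm]
    have hlt : ∀ z : Z, ‖z‖ ≤ 1 → h z < u := fun z hz =>
      (hhT z).trans_lt (hu _ (subset_closure ⟨z, by simpa using hz, rfl⟩))
    have hu0 : 0 < u := by simpa using hlt 0 (by simp)
    have hnorm : ‖h‖ ≤ u := ContinuousLinearMap.opNorm_le_of_unit_norm hu0.le fun z hz => by
      have h₁ := hlt z hz.le
      have h₂ := hlt (-z) (by simp [hz])
      rw [map_neg] at h₂
      exact abs_le.2 ⟨by linarith, h₁.le⟩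
    have hφh : φ h = g p := by
      rw [hg]
      simp [h, p, map_sum, mul_comm]
    linarith [hφ h]

/-- A functional vanishing on `J` is bounded by the quotient norm. -/
theorem abs_apply_le_norm_mul_norm_mkQ {X : Type*} [SeminormedAddCommGroup X] [NormedSpace ℝ X]
    {J : Submodule ℝ X} (h : X →L[ℝ] ℝ) (hJ : ∀ z ∈ J, h z = 0) (w : X) :
    |h w| ≤ ‖h‖ * ‖J.mkQ w‖ := by
  have key : ∀ ε > 0, |h w| ≤ ‖h‖ * (‖J.mkQ w‖ + ε) := fun ε hε => by
    obtain ⟨m, hm, hmlt⟩ := Submodule.Quotient.norm_mk_lt (J.mkQ w) hε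
    have hmw : h w = h m := by
      have := hJ _ ((Submodule.Quotient.eq J).1 hm)
      rw [map_sub] at this
      linarith
    rw [hmw]
    exact (h.le_opNorm m).trans (mul_le_mul_of_nonneg_left hmlt.le (norm_nonneg h))
  have hlim : Filter.Tendsto (fun ε : ℝ => ‖h‖ * (‖J.mkQ w‖ + ε)) (nhdsWithin 0 (Set.Ioi 0))
      (nhds (‖h‖ * (‖J.mkQ w‖ + 0))) :=
    (Continuous.tendsto (by fun_prop) 0).mono_left nhdsWithin_le_nhds
  rw [add_zero] at hlim
  exact ge_of_tendsto hlim (Filter.eventually_of_mem self_mem_nhdsWithin key)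

/-- Points of weak-to-norm continuity pass to quotients by M-ideals. -/
theorem IsWeakNormPC.mkQ {X : Type*} [SeminormedAddCommGroup X] [NormedSpace ℝ X]
    {J : Submodule ℝ X} (hM : IsMIdeal X J) {x₀ : X} (hx₀ : ‖x₀‖ ≤ 1)
    (hPC : IsWeakNormPC X x₀) : IsWeakNormPC (X ⧸ J) (J.mkQ x₀) := by
  classical
  obtain ⟨P, hPP, hker, hnorm⟩ := hM
  have hvanish : ∀ f : X →L[ℝ] ℝ, ∀ z ∈ J, (f - P f) z = 0 := fun f => by
    rw [← hker, map_sub, sub_eq_zero]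
    exact (DFunLike.congr_fun hPP f).symm
  rw [isWeakNormPC_iff] at hPC ⊢
  intro ε hε
  obtain ⟨F, δ, hδ, hF⟩ := hPC (ε / 2) (half_pos hε)
  let L : (X →L[ℝ] ℝ) → (X ⧸ J →L[ℝ] ℝ) := fun f => J.liftQL (f - P f) (hvanish f)
  refine ⟨F.image L, δ / 2, half_pos hδ, fun y hy hyF => ?_⟩
  obtain ⟨w, rfl⟩ := J.mkQ_surjective y
  let φ : (X →L[ℝ] ℝ) →L[ℝ] ℝ :=
    (ContinuousLinearMap.apply ℝ ℝ x₀).comp P +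
      (ContinuousLinearMap.apply ℝ ℝ w).comp (ContinuousLinearMap.id ℝ _ - P)
  have hφ_apply : ∀ f, φ f = P f x₀ + (f - P f) w := fun f => rfl
  have hφ : ∀ f, φ f ≤ ‖f‖ := fun f => by
    have h₁ : P f x₀ ≤ ‖P f‖ := (le_abs_self _).trans
      (((P f).le_opNorm x₀).trans (mul_le_of_le_one_right (norm_nonneg _) hx₀))
    have h₂ : (f - P f) w ≤ ‖f - P f‖ := (le_abs_self _).trans
      ((abs_apply_le_norm_mul_norm_mkQ _ (hvanish f) w).trans
        (mul_le_of_le_one_right (norm_nonneg _) hy))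
    rw [hφ_apply, hnorm f]
    exact add_le_add h₁ h₂
  obtain ⟨g, hg, hgw⟩ := exists_dual_vector'' ℝ (J.mkQ w - J.mkQ x₀)
  let k : X →L[ℝ] ℝ := g.comp J.mkQL
  have hk : ∀ x, k x = g (J.mkQ x) := fun x => rfl
  have hPk : P k = 0 := (hker k).2 fun z hz => by
    rw [hk, J.mkQ_apply, (Submodule.Quotient.mk_eq_zero J).2 hz, map_zero]
  have hk_le : ∀ x, k x ≤ ‖x‖ := fun x =>
    (le_abs_self _).trans <| (g.le_opNorm _).trans <|
      (mul_le_of_le_one_left (norm_nonneg _) hg).trans (Submodule.Quotient.norm_mk_le J x)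
  obtain ⟨z, hz, hzF⟩ := exists_norm_le_one_forall_abs_sub_lt φ.toLinearMap hφ (insert k F)
    (lt_min (half_pos hδ) (half_pos hε))
  have hzx : ‖z - x₀‖ < ε / 2 := hF z hz fun f hf => by
    have h₁ : |f z - φ f| < δ / 2 :=
      (hzF f (Finset.mem_insert_of_mem hf)).trans_le (min_le_left _ _)
    have h₂ : |(f - P f) w - (f - P f) x₀| < δ / 2 := hyF (L f) (Finset.mem_image_of_mem L hf)
    have h₃ : f z - f x₀ = (f z - φ f) + ((f - P f) w - (f - P f) x₀) := by
      rw [hφ_apply]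
      simp only [sub_apply]
      ring
    rw [h₃]
    linarith [abs_add_le (f z - φ f) ((f - P f) w - (f - P f) x₀)]
  have h₁ : |k z - φ k| < ε / 2 :=
    (hzF k (Finset.mem_insert_self k F)).trans_le (min_le_right _ _)
  have h₂ : φ k = k w := by simp [hφ_apply, hPk]
  have h₃ : ‖J.mkQ w - J.mkQ x₀‖ = k w - k x₀ := by
    rw [hk, hk, ← map_sub g]
    exact hgw.symm
  have h₄ := hk_le (z - x₀)
  rw [map_sub] at h₄
  rw [h₂] at h₁
  linarith [(abs_lt.1 h₁).1]

/-- In an infinite-dimensional normed space, points of weak-to-norm continuity of the unit ball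
lie on the unit sphere. -/
theorem IsWeakNormPC.one_le_norm {Z : Type*} [NormedAddCommGroup Z] [NormedSpace ℝ Z]
    (hdim : ¬ FiniteDimensional ℝ Z) {z₀ : Z} (hPC : IsWeakNormPC Z z₀) : 1 ≤ ‖z₀‖ := by
  by_contra! hlt
  obtain ⟨F, δ, hδ, hF⟩ := isWeakNormPC_iff.1 hPC (1 - ‖z₀‖) (sub_pos.2 hlt)
  let T : Z →ₗ[ℝ] (F → ℝ) := LinearMap.pi fun f => (f : Z →L[ℝ] ℝ).toLinearMap
  have hker : LinearMap.ker T ≠ ⊥ := fun h =>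
    hdim (Module.Finite.of_injective T (LinearMap.ker_eq_bot.1 h))
  obtain ⟨y, hyT, hy⟩ := Submodule.exists_mem_ne_zero_of_ne_bot hker
  have hy0 : ‖y‖ ≠ 0 := norm_ne_zero_iff.2 hy
  let v : Z := ((1 - ‖z₀‖) / ‖y‖) • y
  have hv : ‖v‖ = 1 - ‖z₀‖ := by
    rw [norm_smul, norm_div, norm_norm, Real.norm_of_nonneg (sub_pos.2 hlt).le,
      div_mul_cancel₀ _ hy0]
  have := hF (z₀ + v) ((norm_add_le _ _).trans (by linarith)) fun f hf => by
    have hfy : f y = 0 := congr_fun (LinearMap.mem_ker.1 hyT) ⟨f, hf⟩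
    simpa [v, hfy] using hδ
  rw [add_sub_cancel_left, hv] at this
  exact lt_irrefl _ this

theorem stmt11 (X : Type*) [NormedAddCommGroup X] [NormedSpace ℝ X] [CompleteSpace X]
    (J : Submodule ℝ X) (hJclosed : IsClosed (J : Set X))
    (hM : IsMIdeal X J) (hproper : ¬ IsMSummand X J)
    -- `J` has infinite codimension:
    (hcodim : ¬ FiniteDimensional ℝ (X ⧸ J))
    (x₀ : X) (hx₀ : ‖x₀‖ = 1)
    (hPC : IsWeakNormPC X x₀) :
    Metric.infDist x₀ (J : Set X) = 1 ∧
    IsWeakNormPC (X ⧸ J) (J.mkQ x₀) ∧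
    x₀ ∉ J := by
  have hdist : ‖J.mkQ x₀‖ = Metric.infDist x₀ (J : Set X) :=
    QuotientAddGroup.norm_mk (S := J.toAddSubgroup) x₀
  have hPCq : IsWeakNormPC (X ⧸ J) (J.mkQ x₀) := hPC.mkQ hM hx₀.le
  have hone : Metric.infDist x₀ (J : Set X) = 1 := by
    rw [← hdist]
    exact le_antisymm ((Submodule.Quotient.norm_mk_le J x₀).trans_eq hx₀)
      (IsWeakNormPC.one_le_norm hcodim hPCq)
  refine ⟨hone, hPCq, fun hmem => ?_⟩
  rw [Metric.infDist_zero_of_mem hmem] at hone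
  exact zero_ne_one hone

end
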